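/- arXiv:alg-geom/9710029 — 6 statements merged into one kernel-verified Lean document; each statement's English description precedes it below -/
import Mathlib

section
/- Let x, b, a₁, …, a₈ be integers satisfying the system (†): a₁² + ⋯ + a₈² = x + b² and −(a₁ + ⋯ + a₈) = x − 2 + 3b. If x ≥ 3 and b > 0, then b ≤ 2. -/
/-- Any integer solution of the system (†) with `x ≥ 3` and `b > 0` has `b ≤ 2`. -/
theorem dagger_pos_b_le_two (x b : ℤ) (a : Fin 8 → ℤ)
    (h1 : ∑ i, (a i) ^ 2 = x + b ^ 2)
    (h2 : -(∑ i, a i) = x - 2 + 3 * b)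
    (hx : 3 ≤ x) (hb : 0 < b) : b ≤ 2 := by
  have hc := sq_sum_le_card_mul_sum_sq (s := (Finset.univ : Finset (Fin 8))) (f := a)
  rw [h1, show ∑ i, a i = -(x - 2 + 3 * b) by linarith] at hc
  simp only [Finset.card_univ, Fintype.card_fin] at hc
  push_cast at hc
  by_contra hlt
  have h3 : 0 ≤ b - 3 := by omega
  have h4 : 0 ≤ x - 3 := by omega
  nlinarith [mul_nonneg h3 h4, mul_nonneg h3 h3, mul_nonneg h4 h4]
end

section
/- Let x, b, a₁, …, a₈ be integers satisfying the system (†): a₁² + ⋯ + a₈² = x + b² and −(a₁ + ⋯ + a₈) = x − 2 + 3b. If 1 ≤ b ≤ 2, then every aᵢ is equal to −1 or 0, and the number of indices i with aᵢ = −1 is exactly x + b². -/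
/-- If `1 ≤ b ≤ 2`, the integer solutions of (†) have every `aᵢ ∈ {-1, 0}`, with exactly
`x + b²` of them equal to `-1`. -/
theorem dagger_b_one_two_classification (x b : ℤ) (a : Fin 8 → ℤ)
    (h1 : ∑ i, (a i) ^ 2 = x + b ^ 2)
    (h2 : -(∑ i, a i) = x - 2 + 3 * b)
    (hb1 : 1 ≤ b) (hb2 : b ≤ 2) :
    (∀ i, a i = -1 ∨ a i = 0) ∧
      ((Finset.univ.filter fun i => a i = -1).card : ℤ) = x + b ^ 2 := by
  have hs : ∑ i, ((a i) ^ 2 + a i) = 0 := by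
    rw [Finset.sum_add_distrib]
    have hb : b = 1 ∨ b = 2 := by omega
    rcases hb with rfl | rfl <;> linarith
  have hnn : ∀ i ∈ Finset.univ, 0 ≤ (a i) ^ 2 + a i := by
    intro i _
    rcases le_or_gt 0 (a i) with h | h
    · positivity
    · have h' : a i + 1 ≤ 0 := by omega
      nlinarith
  have hz : ∀ i, a i = -1 ∨ a i = 0 := by
    intro i
    have h := (Finset.sum_eq_zero_iff_of_nonneg hnn).1 hs i (Finset.mem_univ i)
    have h' : (a i + 1) * a i = 0 := by linarith
    rcases mul_eq_zero.1 h' with h | h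
    · left; omega
    · right; exact h
  refine ⟨hz, ?_⟩
  rw [← h1, Finset.card_filter]
  push_cast
  refine Finset.sum_congr rfl fun i _ => ?_
  rcases hz i with h | h <;> simp [h]
end

section
/- Let x ≥ 3 be an integer. A tuple of integers (b, a₁, …, a₈) with b > 0 satisfies the system (†): a₁² + ⋯ + a₈² = x + b² and −(a₁ + ⋯ + a₈) = x − 2 + 3b, if and only if b ∈ {1, 2}, every aᵢ ∈ {−1, 0}, and exactly x + b² of the aᵢ are equal to −1. -/
/-- Complete classification of integer solutions of (†) with `b > 0`, for `x ≥ 3`. -/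
theorem dagger_classification (x : ℤ) (hx : 3 ≤ x) (b : ℤ) (hb : 0 < b) (a : Fin 8 → ℤ) :
    (∑ i, (a i) ^ 2 = x + b ^ 2 ∧ -(∑ i, a i) = x - 2 + 3 * b) ↔
      ((b = 1 ∨ b = 2) ∧ (∀ i, a i = -1 ∨ a i = 0) ∧
        ((Finset.univ.filter fun i => a i = -1).card : ℤ) = x + b ^ 2) := by
  have key : (∀ i, a i = -1 ∨ a i = 0) →
      ((Finset.univ.filter fun i => a i = -1).card : ℤ) = ∑ i, (a i) ^ 2 ∧
      ((Finset.univ.filter fun i => a i = -1).card : ℤ) = -∑ i, a i := by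
    intro h
    rw [Finset.card_filter, ← Finset.sum_neg_distrib]
    push_cast
    constructor <;>
    · refine Finset.sum_congr rfl fun i _ => ?_
      rcases h i with h | h <;> simp [h]
  constructor
  · rintro ⟨h1, h2⟩
    have hcs : (∑ i, a i) ^ 2 ≤ 8 * ∑ i, (a i) ^ 2 := by
      have := sq_sum_le_card_mul_sum_sq (s := Finset.univ) (f := a)
      simpa using this
    have h3 : ∑ i, a i = -(x - 2 + 3 * b) := by linarith
    rw [h1, h3] at hcs
    have hb3 : b < 3 := by
      by_contra hc
      have hc : 3 ≤ b := by omega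
      nlinarith [mul_nonneg (sub_nonneg.2 hc) (sub_nonneg.2 hx)]
    have hb' : b = 1 ∨ b = 2 := by omega
    have hz : ∑ i, a i * (a i + 1) = 0 := by
      have : ∑ i, a i * (a i + 1) = ∑ i, (a i) ^ 2 + ∑ i, a i := by
        rw [← Finset.sum_add_distrib]
        exact Finset.sum_congr rfl fun i _ => by ring
      rw [this, h1, h3]
      rcases hb' with rfl | rfl <;> ring
    have hn : ∀ i ∈ Finset.univ, 0 ≤ a i * (a i + 1) := by
      intro i _
      rcases le_or_gt 0 (a i) with h | h
      · positivity
      · exact mul_nonneg_of_nonpos_of_nonpos h.le (by omega)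
    have hall : ∀ i, a i = -1 ∨ a i = 0 := by
      intro i
      have := (Finset.sum_eq_zero_iff_of_nonneg hn).1 hz i (Finset.mem_univ i)
      rcases mul_eq_zero.1 this with h | h
      · exact Or.inr h
      · left; omega
    exact ⟨hb', hall, (key hall).1.trans h1⟩
  · rintro ⟨hb', hall, hc⟩
    obtain ⟨k1, k2⟩ := key hall
    refine ⟨k1.symm.trans hc, ?_⟩
    rw [← k2, hc]
    rcases hb' with rfl | rfl <;> ring
end

section
/- Let x ≥ 3 be a real number and let b > 0 and a₁, …, a₈ be real numbers satisfying the system (†): a₁² + ⋯ + a₈² = x + b² and −(a₁ + ⋯ + a₈) = x − 2 + 3b. Then b < 3. -/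
/-- Any real solution of the system (†) with `x ≥ 3` and `b > 0` has `b < 3`. -/
theorem dagger_real_b_lt_three (x b : ℝ) (a : Fin 8 → ℝ)
    (hx : 3 ≤ x) (hb : 0 < b)
    (h1 : ∑ i, (a i) ^ 2 = x + b ^ 2)
    (h2 : -(∑ i, a i) = x - 2 + 3 * b) : b < 3 := by
  have h := sq_sum_le_card_mul_sum_sq (s := Finset.univ) (f := a)
  have h3 : ∑ i, a i = -(x - 2 + 3 * b) := by linarith
  rw [h1, h3] at h
  simp only [Finset.card_univ, Fintype.card_fin] at h
  push_cast at h
  by_contra! hc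
  nlinarith [mul_nonneg (sub_nonneg.2 hx) (sub_nonneg.2 hc), sq_nonneg (x - 3), sq_nonneg (b - 3)]
end

section
/- Let m be an integer with 0 ≤ m ≤ 8, let c₂ be an integer, and set x = 4c₂ − (1 − m). Suppose x ≥ 3 and that integers b > 0 and a₁, …, a₈ satisfy the system (†): a₁² + ⋯ + a₈² = x + b² and −(a₁ + ⋯ + a₈) = x − 2 + 3b, with b odd, aᵢ odd for 1 ≤ i ≤ m, and aᵢ even for m < i ≤ 8. Then b = 1, aᵢ = −1 for 1 ≤ i ≤ m, aᵢ = 0 for m < i ≤ 8, m = x + 1, and c₂ = 0. -/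
/-- For `c₁ = H + E₁ + ⋯ + E_m`, the only component-creating wall: if `x = 4c₂ - (1 - m)`,
`x ≥ 3`, and `(b, a₁, …, a₈)` solves (†) with `b > 0` odd, `aᵢ` odd for the first `m`
indices and even for the rest, then `b = 1`, the first `m` of the `aᵢ` equal `-1`, the
rest equal `0`, `m = x + 1`, and `c₂ = 0`. -/
theorem dagger_wall_case_one (m : ℕ) (hm : m ≤ 8) (c₂ x b : ℤ) (a : Fin 8 → ℤ)
    (hxdef : x = 4 * c₂ - (1 - (m : ℤ)))
    (hx : 3 ≤ x) (hb : 0 < b)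
    (h1 : ∑ i, (a i) ^ 2 = x + b ^ 2)
    (h2 : -(∑ i, a i) = x - 2 + 3 * b)
    (hbodd : Odd b)
    (haodd : ∀ i : Fin 8, (i : ℕ) < m → Odd (a i))
    (haeven : ∀ i : Fin 8, m ≤ (i : ℕ) → Even (a i)) :
    b = 1 ∧ (∀ i : Fin 8, (i : ℕ) < m → a i = -1) ∧
      (∀ i : Fin 8, m ≤ (i : ℕ) → a i = 0) ∧ (m : ℤ) = x + 1 ∧ c₂ = 0 := by
  have hcs : (∑ i, a i) ^ 2 ≤ 8 * ∑ i, (a i) ^ 2 := by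
    have h := sq_sum_le_card_mul_sum_sq (s := (Finset.univ : Finset (Fin 8))) (f := a)
    simpa using h
  have hS : ∑ i, a i = -(x - 2 + 3 * b) := by linarith
  rw [hS, h1] at hcs
  have hb1 : b = 1 := by
    by_contra hne
    have hb3 : 3 ≤ b := by
      obtain ⟨k, hk⟩ := hbodd
      omega
    nlinarith [mul_nonneg (sub_nonneg.2 hb3) (sub_nonneg.2 hx), sq_nonneg (x - 3)]
  subst hb1
  have hnn : ∀ i ∈ (Finset.univ : Finset (Fin 8)), 0 ≤ a i ^ 2 + a i := by
    intro i _
    rcases le_or_gt 0 (a i) with h | h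
    · positivity
    · nlinarith
  have hz : ∑ i, (a i ^ 2 + a i) = 0 := by
    rw [Finset.sum_add_distrib, h1, hS]; ring
  have hall : ∀ i, a i = 0 ∨ a i = -1 := by
    intro i
    have h := (Finset.sum_eq_zero_iff_of_nonneg hnn).1 hz i (Finset.mem_univ i)
    have h' : a i * (a i + 1) = 0 := by linarith [h, sq (a i)]
    rcases mul_eq_zero.1 h' with h | h
    · exact Or.inl h
    · exact Or.inr (by linarith)
  have hodd : ∀ i : Fin 8, (i : ℕ) < m → a i = -1 := by
    intro i hi
    obtain ⟨k, hk⟩ := haodd i hi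
    rcases hall i with h | h <;> omega
  have heven : ∀ i : Fin 8, m ≤ (i : ℕ) → a i = 0 := by
    intro i hi
    obtain ⟨k, hk⟩ := haeven i hi
    rcases hall i with h | h <;> omega
  have hform : ∀ i : Fin 8, a i = if (i : ℕ) < m then -1 else 0 := by
    intro i
    split_ifs with h
    · exact hodd i h
    · exact heven i (not_lt.1 h)
  have hsum : ∑ i, a i = -(m : ℤ) := by
    rw [Finset.sum_congr rfl (fun i _ => hform i)]
    clear * - hm
    interval_cases m <;> decide
  have hmx : (m : ℤ) = x + 1 := by linarith
  exact ⟨rfl, hodd, heven, hmx, by omega⟩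
end

section
/- Let m be an integer with 0 ≤ m ≤ 8, let c₂ be an integer, and set x = 4c₂ + m. Suppose x ≥ 3 and that integers b > 0 and a₁, …, a₈ satisfy the system (†): a₁² + ⋯ + a₈² = x + b² and −(a₁ + ⋯ + a₈) = x − 2 + 3b, with b even, aᵢ odd for 1 ≤ i ≤ m, and aᵢ even for m < i ≤ 8. Then b = 2, aᵢ = −1 for 1 ≤ i ≤ m, aᵢ = 0 for m < i ≤ 8, m = x + 4, and c₂ = −1. -/
/-- For `c₁ = E₁ + ⋯ + E_m`, the only component-creating wall: if `x = 4c₂ + m`, `x ≥ 3`,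
and `(b, a₁, …, a₈)` solves (†) with `b > 0` even, `aᵢ` odd for the first `m` indices and
even for the rest, then `b = 2`, the first `m` of the `aᵢ` equal `-1`, the rest equal `0`,
`m = x + 4`, and `c₂ = -1`. -/
theorem dagger_wall_case_two (m : ℕ) (hm : m ≤ 8) (c₂ x b : ℤ) (a : Fin 8 → ℤ)
    (hxdef : x = 4 * c₂ + (m : ℤ))
    (hx : 3 ≤ x) (hb : 0 < b)
    (h1 : ∑ i, (a i) ^ 2 = x + b ^ 2)
    (h2 : -(∑ i, a i) = x - 2 + 3 * b)
    (hbeven : Even b)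
    (haodd : ∀ i : Fin 8, (i : ℕ) < m → Odd (a i))
    (haeven : ∀ i : Fin 8, m ≤ (i : ℕ) → Even (a i)) :
    b = 2 ∧ (∀ i : Fin 8, (i : ℕ) < m → a i = -1) ∧
      (∀ i : Fin 8, m ≤ (i : ℕ) → a i = 0) ∧ (m : ℤ) = x + 4 ∧ c₂ = -1 := by
  have hcs : (∑ i, a i) ^ 2 ≤ 8 * ∑ i, (a i) ^ 2 := by
    have h := sq_sum_le_card_mul_sum_sq (s := (Finset.univ : Finset (Fin 8))) (f := a)
    simpa using h
  have hs : ∑ i, a i = -(x - 2 + 3 * b) := by linarith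
  rw [h1, hs] at hcs
  obtain ⟨k, hk⟩ := hbeven
  have hb2 : b = 2 := by
    by_contra hne
    have hb4 : 4 ≤ b := by omega
    nlinarith [mul_nonneg (by linarith : (0 : ℤ) ≤ b - 4) (by linarith : (0 : ℤ) ≤ x - 3)]
  subst hb2
  have hz : ∑ i, ((a i) ^ 2 + a i) = 0 := by
    rw [Finset.sum_add_distrib, h1, hs]; ring
  have hnn : ∀ n : ℤ, 0 ≤ n ^ 2 + n := by
    intro n
    rcases le_or_gt 0 n with h | h
    · positivity
    · nlinarith
  have h01 : ∀ i, a i = 0 ∨ a i = -1 := by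
    intro i
    have h := (Finset.sum_eq_zero_iff_of_nonneg (fun i _ => hnn (a i))).1 hz i (Finset.mem_univ i)
    have h' : a i * (a i + 1) = 0 := by linarith
    rcases mul_eq_zero.1 h' with h | h
    · exact Or.inl h
    · exact Or.inr (by linarith)
  have hA : ∀ i : Fin 8, (i : ℕ) < m → a i = -1 := by
    intro i hi
    obtain ⟨r, hr⟩ := haodd i hi
    have := h01 i
    omega
  have hB : ∀ i : Fin 8, m ≤ (i : ℕ) → a i = 0 := by
    intro i hi
    obtain ⟨r, hr⟩ := haeven i hi
    have := h01 i
    omega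
  have hsum : ∑ i, a i = -(m : ℤ) := by
    have he : ∀ i : Fin 8, a i = if (i : ℕ) < m then -1 else 0 := by
      intro i
      split_ifs with h
      · exact hA i h
      · exact hB i (not_lt.1 h)
    rw [Finset.sum_congr rfl (fun i _ => he i)]
    clear * - hm
    interval_cases m <;> decide
  have hmx : (m : ℤ) = x + 4 := by linarith
  exact ⟨rfl, hA, hB, hmx, by linarith⟩
end
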